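/- arXiv:math/0702028 — 2 statements merged into one kernel-verified Lean document; each statement's English description precedes it below -/
import Mathlib

section
/- Let M be a nonzero uniformly finite R-module, N a submodule with N ≠ M, and N = N₁ ∩ ⋯ ∩ N_s a shortest primary decomposition of N in M with As_R(M/N_i) = {X_i}. Then: (1) there exist nonzero submodules W₁, ..., W_s of M/N such that the sum W₁ + ⋯ + W_s is direct and essential in M/N and As_R(W_i) = {X_i} for each i; (2) for each i there exists a complement C_i to W_i in M/N containing Σ_{j≠i} W_j such that Σ_{j≠i} W_j ⊆ N_i/N ⊆ C_i. Conversely, given any nonzero submodules W₁', ..., W_s' of M/N whose sum is direct and essential in M/N with As_R(W_i') = {X_i} for each i, any complements C_i' to W_i' in M/N containing Σ_{j≠i} W_j', and any submodules N_i' of M containing N with As_R(M/N_i') = {X_i} and Σ_{j≠i} W_j' ⊆ N_i'/N ⊆ C_i', one has that N = N₁' ∩ ⋯ ∩ N_s' is a shortest primary decomposition of N in M; moreover every shortest primary decomposition of N in M arises in this way. -/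
/-!
Definitions following Bavula, "Primary decompositions for left Noetherian rings".
All modules are left modules over an associative ring `R` with 1.
-/

universe u v

section Defs

variable (R : Type u) [Ring R]

/-- `N` is an essential submodule of the module `A`:
it intersects every nonzero submodule of `A` nontrivially. -/
def EssentialSub {A : Type v} [AddCommGroup A] [Module R A] (N : Submodule R A) : Prop :=
  ∀ L : Submodule R A, L ≠ ⊥ → N ⊓ L ≠ ⊥

/-- A module `A` is uniform: it is nonzero and every nonzero submodule is essential. -/
def UniformMod (A : Type v) [AddCommGroup A] [Module R A] : Prop :=
  Nontrivial A ∧ ∀ V : Submodule R A, V ≠ ⊥ → EssentialSub R V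

/-- A submodule is uniform if it is uniform as a module. -/
def UniformSub {A : Type v} [AddCommGroup A] [Module R A] (U : Submodule R A) : Prop :=
  UniformMod R ↥U

/-- `A` has finite uniform dimension:
it contains no infinite direct sum of nonzero submodules. -/
def FinUdim (A : Type v) [AddCommGroup A] [Module R A] : Prop :=
  ¬ ∃ f : ℕ → Submodule R A, (∀ n, f n ≠ ⊥) ∧ iSupIndep f

/-- `A` has uniform dimension `n`: there is an essential direct sum of `n`
uniform submodules of `A`. -/
def UdimEq (A : Type v) [AddCommGroup A] [Module R A] (n : ℕ) : Prop :=
  ∃ U : Fin n → Submodule R A, (∀ i, UniformSub R (U i)) ∧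
    iSupIndep U ∧ EssentialSub R (⨆ i, U i)

/-- Essential equivalence of modules: they possess isomorphic essential submodules. -/
def EssEquiv (A B : ModuleCat.{v} R) : Prop :=
  ∃ (L₁ : Submodule R A) (L₂ : Submodule R B),
    EssentialSub R L₁ ∧ EssentialSub R L₂ ∧ Nonempty (L₁ ≃ₗ[R] L₂)

/-- The left spectrum-style quotient: classes `[A]` of modules under essential
equivalence (for uniform modules these classes are the left primes). -/
def LeftSpec := Quot (EssEquiv R)

/-- The class `[A]` of the module `A` under essential equivalence. -/
def leftPrime (A : Type v) [AddCommGroup A] [Module R A] : LeftSpec.{u, v} R :=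
  Quot.mk _ (ModuleCat.of R A)

/-- The set `As_R(A)` of associated left primes of `A`:
the classes of the uniform submodules of `A`. -/
def leftAss (A : Type v) [AddCommGroup A] [Module R A] : Set (LeftSpec.{u, v} R) :=
  { x | ∃ U : Submodule R A, UniformSub R U ∧ x = leftPrime R ↥U }

/-- `A` is uniformly finite: every factor module of `A` has finite uniform dimension. -/
def UniformlyFinite (A : Type v) [AddCommGroup A] [Module R A] : Prop :=
  ∀ N : Submodule R A, FinUdim R (A ⧸ N)

/-- `N` is an `X`-primary submodule of `A`: `A/N` has finite uniform dimension and
`As_R(A/N) = {X}`. -/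
def PrimarySub {A : Type v} [AddCommGroup A] [Module R A] (N : Submodule R A)
    (X : LeftSpec.{u, v} R) : Prop :=
  FinUdim R (A ⧸ N) ∧ leftAss R (A ⧸ N) = {X}

/-- `Ns` is a primary decomposition of `N` in `A`. -/
def IsPrimaryDecomp {A : Type v} [AddCommGroup A] [Module R A] (N : Submodule R A)
    (s : ℕ) (Ns : Fin s → Submodule R A) : Prop :=
  N = ⨅ i, Ns i ∧ ∀ i, ∃ X, PrimarySub R (Ns i) X

/-- `Ns` is a shortest primary decomposition of `N` in `A`:
no primary decomposition of `N` in `A` has fewer terms. -/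
def IsShortestPrimaryDecomp {A : Type v} [AddCommGroup A] [Module R A] (N : Submodule R A)
    (s : ℕ) (Ns : Fin s → Submodule R A) : Prop :=
  IsPrimaryDecomp R N s Ns ∧
    ∀ (t : ℕ) (Ls : Fin t → Submodule R A), IsPrimaryDecomp R N t Ls → s ≤ t

/-- `C` is a complement to `W` in the ambient module: `W ⊓ C = ⊥` and `C` is maximal
with this property. -/
def IsComplementTo {A : Type v} [AddCommGroup A] [Module R A] (C W : Submodule R A) : Prop :=
  W ⊓ C = ⊥ ∧ ∀ D : Submodule R A, C ≤ D → W ⊓ D = ⊥ → D = C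

/-- A proper submodule `N ⊊ A` is irreducible if it is not the intersection of two
strictly larger submodules. -/
def IrreducibleSub {A : Type v} [AddCommGroup A] [Module R A] (N : Submodule R A) : Prop :=
  N ≠ ⊤ ∧ ¬ ∃ P Q : Submodule R A, N < P ∧ N < Q ∧ N = P ⊓ Q

/-- The multiplicity of the left prime `x` in `A` is `m`: in some (equivalently, any)
essential direct sum of uniform submodules of `A`, exactly `m` summands lie in class `x`. -/
def HasMult (A : Type v) [AddCommGroup A] [Module R A] (x : LeftSpec.{u, v} R) (m : ℕ) : Prop :=
  ∃ (n : ℕ) (U : Fin n → Submodule R A), (∀ i, UniformSub R (U i)) ∧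
    iSupIndep U ∧ EssentialSub R (⨆ i, U i) ∧
    m = Nat.card {i : Fin n // leftPrime R ↥(U i) = x}

end Defs

section AssociatedLeftPrimes

variable {R : Type u} [Ring R] {A B : Type v} [AddCommGroup A] [Module R A]
  [AddCommGroup B] [Module R B]

theorem uniformSub_iff {U : Submodule R A} :
    UniformSub R U ↔ U ≠ ⊥ ∧ ∀ V ≤ U, ∀ W ≤ U, V ≠ ⊥ → W ≠ ⊥ → V ⊓ W ≠ ⊥ := by
  have hinj := Submodule.map_injective_of_injective U.injective_subtype
  have hbot (V : Submodule R U) : V.map U.subtype = ⊥ ↔ V = ⊥ :=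
    ⟨fun h => hinj (by simpa using h), fun h => by simp [h]⟩
  refine and_congr (Submodule.nontrivial_iff_ne_bot) ⟨fun h V hV W hW hV0 hW0 => ?_,
    fun h V hV W hW => ?_⟩
  · have hV' : (V.comap U.subtype).map U.subtype = V := by simpa using hV
    have hW' : (W.comap U.subtype).map U.subtype = W := by simpa using hW
    have := h (V.comap U.subtype) (fun h0 => hV0 (by rw [← hV', h0, Submodule.map_bot]))
      (W.comap U.subtype) (fun h0 => hW0 (by rw [← hW', h0, Submodule.map_bot]))
    rw [ne_eq, ← hbot, Submodule.map_inf _ U.injective_subtype, hV', hW'] at this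
    exact this
  · have := h _ (Submodule.map_subtype_le U V) _ (Submodule.map_subtype_le U W)
      (mt (hbot V).1 hV) (mt (hbot W).1 hW)
    rwa [← Submodule.map_inf _ U.injective_subtype, ne_eq, hbot] at this

theorem UniformSub.ne_bot {U : Submodule R A} (hU : UniformSub R U) : U ≠ ⊥ :=
  (uniformSub_iff.1 hU).1

theorem UniformSub.inf_ne_bot {U V W : Submodule R A} (hU : UniformSub R U)
    (hV : U ⊓ V ≠ ⊥) (hW : U ⊓ W ≠ ⊥) : U ⊓ (V ⊓ W) ≠ ⊥ := by
  have := (uniformSub_iff.1 hU).2 _ inf_le_left _ inf_le_left hV hW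
  rwa [← inf_inf_distrib_left] at this

theorem UniformSub.finset_inf_ne_bot {ι : Type*} {U : Submodule R A} (hU : UniformSub R U)
    (K : ι → Submodule R A) (t : Finset ι) (h : ∀ i ∈ t, U ⊓ K i ≠ ⊥) : U ⊓ t.inf K ≠ ⊥ := by
  classical
  induction t using Finset.induction_on with
  | empty => simpa using hU.ne_bot
  | insert a t _ ih =>
    rw [Finset.inf_insert]
    exact hU.inf_ne_bot (h a (by simp)) (ih fun i hi => h i (by simp [hi]))

theorem UniformSub.mono {U V : Submodule R A} (hU : UniformSub R U) (hVU : V ≤ U) (hV : V ≠ ⊥) :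
    UniformSub R V :=
  uniformSub_iff.2 ⟨hV, fun P hP Q hQ => (uniformSub_iff.1 hU).2 P (hP.trans hVU) Q (hQ.trans hVU)⟩

theorem essentialSub_top : EssentialSub R (⊤ : Submodule R A) := fun L hL => by simpa using hL

theorem leftPrime_congr (e : A ≃ₗ[R] B) : leftPrime R A = leftPrime R B :=
  Quot.sound ⟨⊤, ⊤, essentialSub_top, essentialSub_top,
    ⟨Submodule.topEquiv.trans (e.trans Submodule.topEquiv.symm)⟩⟩

theorem UniformSub.leftPrime_eq {U V : Submodule R A} (hU : UniformSub R U) (hVU : V ≤ U)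
    (hV : V ≠ ⊥) : leftPrime R V = leftPrime R U := by
  refine Quot.sound ⟨⊤, V.comap U.subtype, essentialSub_top, hU.2 _ fun h => hV ?_,
    ⟨Submodule.topEquiv.trans (Submodule.comapSubtypeEquivOfLe hVU).symm⟩⟩
  have hV' : (V.comap U.subtype).map U.subtype = V := by simpa using hVU
  rw [← hV', h, Submodule.map_bot]

/-- A linear map restricts to an isomorphism on a submodule disjoint from its kernel. -/
noncomputable def equivMapOfDisjointKer (f : A →ₗ[R] B) (U : Submodule R A)
    (h : Disjoint U (LinearMap.ker f)) : U ≃ₗ[R] U.map f :=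
  LinearEquiv.ofBijective (f.submoduleMap U)
    ⟨by
      rw [← LinearMap.ker_eq_bot, LinearMap.ker_eq_bot']
      rintro ⟨x, hx⟩ h0
      exact Subtype.ext (Submodule.disjoint_def.1 h x hx (by simpa using congrArg Subtype.val h0)),
    f.submoduleMap_surjective U⟩

theorem UniformMod.congr (e : A ≃ₗ[R] B) (h : UniformMod R A) : UniformMod R B := by
  have hbot (V : Submodule R B) : V.comap e.toLinearMap = ⊥ ↔ V = ⊥ :=
    ⟨fun h => Submodule.comap_injective_of_surjective e.surjective
      (by rw [h]; simp), fun h => by subst h; simp⟩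
  obtain ⟨hnt, hess⟩ := h
  refine ⟨e.symm.toEquiv.nontrivial, fun V hV W hW => ?_⟩
  have := hess _ (mt (hbot V).1 hV) _ (mt (hbot W).1 hW)
  rwa [← Submodule.comap_inf, ne_eq, hbot] at this

theorem UniformSub.map {U : Submodule R A} (hU : UniformSub R U) (f : A →ₗ[R] B)
    (h : Disjoint U (LinearMap.ker f)) : UniformSub R (U.map f) :=
  UniformMod.congr (equivMapOfDisjointKer f U h) hU

theorem leftPrime_map (U : Submodule R A) (f : A →ₗ[R] B)
    (h : Disjoint U (LinearMap.ker f)) : leftPrime R (U.map f) = leftPrime R U :=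
  (leftPrime_congr (equivMapOfDisjointKer f U h)).symm

theorem UniformSub.leftPrime_mem {U : Submodule R A} (hU : UniformSub R U) (f : A →ₗ[R] B)
    (h : Disjoint U (LinearMap.ker f)) : leftPrime R U ∈ leftAss R B :=
  ⟨U.map f, hU.map f h, (leftPrime_map U f h).symm⟩

theorem leftAss_congr (e : A ≃ₗ[R] B) : leftAss R A = leftAss R B := by
  refine Set.Subset.antisymm ?_ ?_
  · rintro _ ⟨U, hU, rfl⟩
    exact hU.leftPrime_mem e.toLinearMap (by simp)
  · rintro _ ⟨U, hU, rfl⟩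
    exact hU.leftPrime_mem e.symm.toLinearMap (by simp)

theorem mem_leftAss_submodule {P : Submodule R A} {x : LeftSpec.{u, v} R} :
    x ∈ leftAss R P ↔ ∃ U ≤ P, UniformSub R U ∧ x = leftPrime R U := by
  constructor
  · rintro ⟨U, hU, rfl⟩
    have hk : Disjoint U (LinearMap.ker P.subtype) := by simp
    exact ⟨U.map P.subtype, Submodule.map_subtype_le P U, hU.map _ hk, (leftPrime_map U _ hk).symm⟩
  · rintro ⟨U, hUP, hU, rfl⟩
    let e := Submodule.comapSubtypeEquivOfLe hUP
    exact ⟨U.comap P.subtype, UniformMod.congr e.symm hU, leftPrime_congr e.symm⟩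

/-- If each `V n` and `L (n + 1)` are disjoint submodules of `L n`, the `V n` are independent. -/
theorem iSupIndep_of_disjoint_succ {V L : ℕ → Submodule R A} (hV : ∀ n, V n ≤ L n)
    (hL : ∀ n, L (n + 1) ≤ L n) (hd : ∀ n, Disjoint (V n) (L (n + 1))) : iSupIndep V := by
  have hanti : Antitone L := antitone_nat_of_succ_le hL
  rw [iSupIndep_iff_finsetSum_eq_zero_imp_eq_zero]
  intro t v hv hsum i hi
  induction i using Nat.strong_induction_on with
  | _ i ih =>
    refine Submodule.disjoint_def.1 (hd i) _ (hv i hi) ?_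
    rw [← t.add_sum_erase _ hi, add_eq_zero_iff_eq_neg] at hsum
    rw [hsum]
    refine neg_mem (sum_mem fun j hj => ?_)
    obtain ⟨hji, hjt⟩ := Finset.mem_erase.1 hj
    rcases lt_or_gt_of_ne hji with hlt | hgt
    · rw [ih j hlt hjt]
      exact zero_mem _
    · exact hanti hgt (hV j (hv j hjt))

theorem exists_uniformSub_le (hA : FinUdim R A) {P : Submodule R A} (hP : P ≠ ⊥) :
    ∃ U ≤ P, UniformSub R U := by
  by_contra! hno
  have split (L : {L : Submodule R A // L ≤ P ∧ L ≠ ⊥}) :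
      ∃ V : Submodule R A, ∃ L' : {L : Submodule R A // L ≤ P ∧ L ≠ ⊥},
        V ≤ L.1 ∧ V ≠ ⊥ ∧ L'.1 ≤ L.1 ∧ Disjoint V L'.1 := by
    have h := hno L.1 L.2.1
    rw [uniformSub_iff] at h
    push Not at h
    obtain ⟨V, hV, W, hW, hV0, hW0, hVW⟩ := h L.2.2
    exact ⟨V, ⟨W, hW.trans L.2.1, hW0⟩, hV, hV0, hW, disjoint_iff.2 hVW⟩
  choose V next hV hV0 hnext hd using split
  let L : ℕ → {L : Submodule R A // L ≤ P ∧ L ≠ ⊥} := fun n => next^[n] ⟨P, le_rfl, hP⟩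
  have hL (n : ℕ) : L (n + 1) = next (L n) := Function.iterate_succ_apply' _ _ _
  exact hA ⟨fun n => V (L n), fun n => hV0 _, iSupIndep_of_disjoint_succ
    (L := fun n => (L n).1) (fun n => hV _) (fun n => by rw [hL]; exact hnext _)
    (fun n => by rw [hL]; exact hd _)⟩

theorem leftAss_nonempty (hA : FinUdim R A) [Nontrivial A] : (leftAss R A).Nonempty := by
  obtain ⟨U, -, hU⟩ := exists_uniformSub_le hA (P := ⊤) top_ne_bot
  exact ⟨_, U, hU, rfl⟩

theorem map_mkQ_eq_bot {N P : Submodule R A} : P.map N.mkQ = ⊥ ↔ P ≤ N := by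
  rw [← le_bot_iff, Submodule.map_le_iff_le_comap, Submodule.comap_bot, Submodule.ker_mkQ]

/-- A uniform submodule of `P ⊔ Q` disjoint from `P` has its class among those of `Q`. -/
theorem UniformSub.leftPrime_mem_of_le_sup {U P Q : Submodule R A} (hU : UniformSub R U)
    (hUPQ : U ≤ P ⊔ Q) (hPQ : Disjoint P Q) (hUP : Disjoint U P) :
    leftPrime R U ∈ leftAss R Q := by
  have hU' : Disjoint U (LinearMap.ker P.mkQ) := by rwa [Submodule.ker_mkQ]
  have hQ' : Disjoint Q (LinearMap.ker P.mkQ) := by rw [Submodule.ker_mkQ]; exact hPQ.symm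
  rw [leftAss_congr (equivMapOfDisjointKer P.mkQ Q hQ'), mem_leftAss_submodule]
  refine ⟨U.map P.mkQ, ?_, hU.map _ hU', (leftPrime_map U _ hU').symm⟩
  refine (Submodule.map_mono hUPQ).trans ?_
  rw [Submodule.map_sup, map_mkQ_eq_bot.2 le_rfl, bot_sup_eq]

theorem exists_leftPrime_mem_of_le_finset_sup {ι : Type*} (W : ι → Submodule R A)
    (hW : iSupIndep W) (t : Finset ι) {U : Submodule R A} (hU : UniformSub R U) (hUt : U ≤ t.sup W) :
    ∃ i ∈ t, leftPrime R U ∈ leftAss R (W i) := by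
  classical
  induction t using Finset.induction_on generalizing U with
  | empty => exact absurd (le_bot_iff.1 (by simpa using hUt)) hU.ne_bot
  | insert a t ha ih =>
    rw [Finset.sup_insert, sup_comm] at hUt
    have hd : Disjoint (t.sup W) (W a) := by
      have := hW.disjoint_biSup (x := a) (y := (t : Set ι)) (by simpa using ha)
      rw [Finset.sup_eq_iSup]
      exact this.symm
    by_cases h : U ⊓ t.sup W = ⊥
    · exact ⟨a, by simp, hU.leftPrime_mem_of_le_sup hUt hd (disjoint_iff.2 h)⟩
    · obtain ⟨i, hi, hmem⟩ := ih (hU.mono inf_le_left h) inf_le_right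
      rw [hU.leftPrime_eq inf_le_left h] at hmem
      exact ⟨i, by simp [hi], hmem⟩

theorem exists_isComplementTo {W K : Submodule R A} (h : Disjoint W K) :
    ∃ C, K ≤ C ∧ IsComplementTo R C W := by
  obtain ⟨C, hKC, hC⟩ := zorn_le_nonempty₀ {C : Submodule R A | Disjoint W C}
    (fun c hc hchain y hy => ⟨sSup c, (hchain.directedOn.disjoint_sSup_right).2 fun _ hb => hc hb,
      fun _ => le_sSup⟩) K h
  exact ⟨C, hKC, disjoint_iff.1 hC.prop,
    fun D hCD hD => (hC.eq_of_le (disjoint_iff.2 hD) hCD).symm⟩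

/-- For every left prime `x`, there is a submodule `K` not having `x` as an associated left prime
such that `x` is the only possible associated left prime of `A ⧸ K`. -/
theorem exists_leftAss_quotient_subset {x : LeftSpec.{u, v} R} :
    ∃ K : Submodule R A, x ∉ leftAss R K ∧ leftAss R (A ⧸ K) ⊆ {x} := by
  have hbot : (⊥ : Submodule R A) ∈ {K : Submodule R A | x ∉ leftAss R K} := fun h => by
    obtain ⟨U, hU, hU', -⟩ := mem_leftAss_submodule.1 h
    exact hU'.ne_bot (le_bot_iff.1 hU)
  have hsSup (c : Set (Submodule R A)) (hc : c ⊆ {K : Submodule R A | x ∉ leftAss R K})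
      (hchain : IsChain (· ≤ ·) c) : x ∉ leftAss R (sSup c : Submodule R A) := fun hx => by
    obtain ⟨U, hUc, hU, rfl⟩ := mem_leftAss_submodule.1 hx
    have : ∃ k ∈ c, U ⊓ k ≠ ⊥ := by
      by_contra! h
      exact hU.ne_bot (disjoint_self.1 (((hchain.directedOn.disjoint_sSup_right).2
        fun k hk => disjoint_iff.2 (h k hk)).mono_right hUc))
    obtain ⟨k, hk, hUk⟩ := this
    exact hc hk (mem_leftAss_submodule.2
      ⟨_, inf_le_right, hU.mono inf_le_left hUk, (hU.leftPrime_eq inf_le_left hUk).symm⟩)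
  obtain ⟨K, -, hK⟩ := zorn_le_nonempty₀ {K : Submodule R A | x ∉ leftAss R K}
    (fun c hc hchain y hy => ⟨sSup c, hsSup c hc hchain, fun _ => le_sSup⟩) ⊥ hbot
  refine ⟨K, hK.prop, ?_⟩
  rintro _ ⟨V, hV, rfl⟩
  have hlt : ¬ V.comap K.mkQ ≤ K := fun hle => hV.ne_bot <| by
    rw [← Submodule.map_comap_eq_of_surjective K.mkQ_surjective V, ← le_bot_iff]
    exact (Submodule.map_mono hle).trans (map_mkQ_eq_bot.2 le_rfl).le
  have hKV : K ≤ V.comap K.mkQ := Submodule.le_comap_mkQ K V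
  have hx : x ∈ leftAss R (V.comap K.mkQ) := by
    by_contra hx
    exact hlt (hK.le_of_ge hx hKV)
  obtain ⟨U, hUV, hU, rfl⟩ := mem_leftAss_submodule.1 hx
  have hUK : Disjoint U (LinearMap.ker K.mkQ) := by
    rw [Submodule.ker_mkQ, disjoint_iff]
    by_contra h
    exact hK.prop (mem_leftAss_submodule.2
      ⟨_, inf_le_right, hU.mono inf_le_left h, (hU.leftPrime_eq inf_le_left h).symm⟩)
  rw [Set.mem_singleton_iff, ← leftPrime_map U _ hUK]
  exact (hV.leftPrime_eq (Submodule.map_le_iff_le_comap.2 hUV) (hU.map _ hUK).ne_bot).symm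

theorem leftAss_quotient_map_mkQ {N P : Submodule R A} (h : N ≤ P) :
    leftAss R ((A ⧸ N) ⧸ P.map N.mkQ) = leftAss R (A ⧸ P) :=
  leftAss_congr (Submodule.quotientQuotientEquivQuotient N P h)

theorem UniformSub.leftPrime_mem_of_inf_map_mkQ {N P : Submodule R A} (h : N ≤ P)
    {U : Submodule R (A ⧸ N)} (hU : UniformSub R U) (hUP : U ⊓ P.map N.mkQ = ⊥) :
    leftPrime R U ∈ leftAss R (A ⧸ P) := by
  rw [← leftAss_quotient_map_mkQ h]
  exact hU.leftPrime_mem (P.map N.mkQ).mkQ (by rw [Submodule.ker_mkQ]; exact disjoint_iff.2 hUP)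

/-- Finitely many associated left primes yield a primary decomposition with one term for each. -/
theorem exists_isPrimaryDecomp (huf : UniformlyFinite R A) (N : Submodule R A)
    [Finite (leftAss R (A ⧸ N))] :
    ∃ Ls : Fin (Nat.card (leftAss R (A ⧸ N))) → Submodule R A,
      IsPrimaryDecomp R N (Nat.card (leftAss R (A ⧸ N))) Ls := by
  have hK (x : LeftSpec.{u, v} R) := exists_leftAss_quotient_subset (A := A ⧸ N) (x := x)
  choose K hxK hK using hK
  have e := Finite.equivFin (leftAss R (A ⧸ N))
  have hle (x : LeftSpec.{u, v} R) : N ≤ (K x).comap N.mkQ := Submodule.le_comap_mkQ N _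
  have hmap (x : LeftSpec.{u, v} R) : ((K x).comap N.mkQ).map N.mkQ = K x :=
    Submodule.map_comap_eq_of_surjective N.mkQ_surjective _
  refine ⟨fun k => (K (e.symm k)).comap N.mkQ, ?_, fun k => ⟨(e.symm k), huf _, ?_⟩⟩
  · refine le_antisymm (le_iInf fun k => hle _) (map_mkQ_eq_bot.1 ?_)
    by_contra hne
    obtain ⟨U, hU, hUu⟩ := exists_uniformSub_le (huf N) hne
    refine hxK (leftPrime R U) (mem_leftAss_submodule.2 ⟨U, hU.trans ?_, hUu, rfl⟩)
    rw [Submodule.map_le_iff_le_comap]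
    have hmem : leftPrime R U ∈ leftAss R (A ⧸ N) := ⟨U, hUu, rfl⟩
    obtain ⟨k, hk⟩ := e.symm.surjective ⟨_, hmem⟩
    have hkx : (e.symm k).1 = leftPrime R U := congrArg Subtype.val hk
    exact hkx ▸ iInf_le (fun k => (K (e.symm k)).comap N.mkQ) k
  · have hsub : leftAss R (A ⧸ (K (e.symm k)).comap N.mkQ) ⊆ {(e.symm k).1} := by
      rw [← leftAss_quotient_map_mkQ (hle _), hmap]
      exact hK _
    have : Nontrivial (A ⧸ (K (e.symm k)).comap N.mkQ) := by
      rw [Submodule.Quotient.nontrivial_iff]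
      intro htop
      have htop' : K (e.symm k) = ⊤ := by
        rw [← hmap, htop, Submodule.map_top, Submodule.range_mkQ]
      apply hxK (e.symm k)
      rw [htop', leftAss_congr Submodule.topEquiv]
      exact (e.symm k).2
    exact (Set.Nonempty.subset_singleton_iff (leftAss_nonempty (huf _))).1 hsub

theorem finset_inf_map_mkQ_eq_bot {ι : Type*} [Fintype ι] {N : Submodule R A}
    {Ns : ι → Submodule R A} (hN : N = ⨅ i, Ns i) :
    (Finset.univ.inf fun i => (Ns i).map N.mkQ) = ⊥ := by
  have hle (i : ι) : N ≤ Ns i := hN.trans_le (iInf_le _ i)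
  have hcomap : (Finset.univ.inf fun i => (Ns i).map N.mkQ).comap N.mkQ ≤ N := by
    conv_rhs => rw [hN]
    refine le_iInf fun i => (Submodule.comap_mono (Finset.inf_le (Finset.mem_univ i))).trans ?_
    rw [Submodule.comap_map_mkQ, sup_eq_right.2 (hle i)]
  rw [← Submodule.map_comap_eq_of_surjective N.mkQ_surjective (Finset.univ.inf _)]
  exact map_mkQ_eq_bot.2 hcomap

theorem IsPrimaryDecomp.exists_leftPrime_eq {N : Submodule R A} {s : ℕ}
    {Ns : Fin s → Submodule R A} {X : Fin s → LeftSpec.{u, v} R}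
    (hN : IsPrimaryDecomp R N s Ns) (hass : ∀ i, leftAss R (A ⧸ Ns i) = {X i})
    {U : Submodule R (A ⧸ N)} (hU : UniformSub R U) : ∃ i, X i = leftPrime R U := by
  have hle (i : Fin s) : N ≤ Ns i := hN.1.trans_le (iInf_le _ i)
  by_contra! hne
  refine hU.finset_inf_ne_bot (fun i => (Ns i).map N.mkQ) Finset.univ
    (fun i _ h => hne i ?_) (le_bot_iff.1 (inf_le_right.trans ?_))
  · have := hU.leftPrime_mem_of_inf_map_mkQ (hle i) h
    rw [hass i] at this
    exact this.symm
  · exact (finset_inf_map_mkQ_eq_bot hN.1).le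

/-- The left primes of a shortest primary decomposition of `N` are distinct, and each of them
is associated to the quotient by `N`. -/
theorem IsShortestPrimaryDecomp.leftPrimes (huf : UniformlyFinite R A) {N : Submodule R A} {s : ℕ}
    {Ns : Fin s → Submodule R A} {X : Fin s → LeftSpec.{u, v} R}
    (hN : IsShortestPrimaryDecomp R N s Ns) (hass : ∀ i, leftAss R (A ⧸ Ns i) = {X i}) :
    Function.Injective X ∧ ∀ i, X i ∈ leftAss R (A ⧸ N) := by
  have hex (y : leftAss R (A ⧸ N)) : ∃ i, X i = y := by
    obtain ⟨_, U, hU, rfl⟩ := y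
    exact hN.1.exists_leftPrime_eq hass hU
  choose g hg using hex
  have hinj : Function.Injective g := fun y z h => Subtype.ext (by rw [← hg y, ← hg z, h])
  have : Finite (leftAss R (A ⧸ N)) := Finite.of_injective g hinj
  obtain ⟨Ls, hLs⟩ := exists_isPrimaryDecomp huf N
  have hsurj : Function.Surjective g :=
    (hinj.bijective_of_nat_card_le (by simpa using hN.2 _ Ls hLs)).2
  refine ⟨hsurj.forall₂.2 fun y z h => ?_, hsurj.forall.2 fun y => ?_⟩
  · rw [hg, hg] at h
    rw [Subtype.ext h]
  · rw [hg]
    exact y.2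

end AssociatedLeftPrimes

/-- Theorem `clminprdec`, description of shortest primary
decompositions: let `N = N₁ ∩ ⋯ ∩ N_s` be a shortest primary decomposition of a
proper submodule `N` of a nonzero uniformly finite module `M`, with
`As_R(M/Nᵢ) = {Xᵢ}`. Then (1) there are nonzero submodules `W₁, …, W_s` of `M/N`
whose sum is direct and essential with `As_R(Wᵢ) = {Xᵢ}`, and (2) complements `Cᵢ` to
`Wᵢ` containing `Σ_{j≠i} Wⱼ` with `Σ_{j≠i} Wⱼ ⊆ Nᵢ/N ⊆ Cᵢ`. Conversely, any data
`W'`, `C'`, `N'` as in the statement yields a shortest primary decomposition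
`N = N₁' ∩ ⋯ ∩ N_s'`; every shortest primary decomposition of `N` arises this way. -/
theorem shortest_primaryDecomposition_description
    {R : Type u} [Ring R] {M : Type v} [AddCommGroup M] [Module R M]
    (hM : Nontrivial M) (huf : UniformlyFinite R M)
    (N : Submodule R M) (hN : N ≠ ⊤)
    (s : ℕ) (Ns : Fin s → Submodule R M) (X : Fin s → LeftSpec.{u, v} R)
    (hshort : IsShortestPrimaryDecomp R N s Ns)
    (hass : ∀ i, leftAss R (M ⧸ Ns i) = {X i}) :
    (∃ W : Fin s → Submodule R (M ⧸ N),
      (∀ i, W i ≠ ⊥) ∧ iSupIndep W ∧ EssentialSub R (⨆ i, W i) ∧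
      (∀ i, leftAss R ↥(W i) = {X i}) ∧
      ∃ C : Fin s → Submodule R (M ⧸ N),
        ∀ i, (∀ j, j ≠ i → W j ≤ C i) ∧ IsComplementTo R (C i) (W i) ∧
          (⨆ (j) (_ : j ≠ i), W j) ≤ Submodule.map N.mkQ (Ns i) ∧
          Submodule.map N.mkQ (Ns i) ≤ C i) ∧
    (∀ W' : Fin s → Submodule R (M ⧸ N),
      (∀ i, W' i ≠ ⊥) → iSupIndep W' → EssentialSub R (⨆ i, W' i) →
      (∀ i, leftAss R ↥(W' i) = {X i}) →
      ∀ C' : Fin s → Submodule R (M ⧸ N),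
        (∀ i, (∀ j, j ≠ i → W' j ≤ C' i) ∧ IsComplementTo R (C' i) (W' i)) →
      ∀ N' : Fin s → Submodule R M,
        (∀ i, N ≤ N' i) →
        (∀ i, leftAss R (M ⧸ N' i) = {X i}) →
        (∀ i, (⨆ (j) (_ : j ≠ i), W' j) ≤ Submodule.map N.mkQ (N' i) ∧
              Submodule.map N.mkQ (N' i) ≤ C' i) →
        IsShortestPrimaryDecomp R N s N') := by
  obtain ⟨hXinj, hX⟩ := hshort.leftPrimes huf hass
  constructor
  · have hle (i : Fin s) : N ≤ Ns i := hshort.1.1.trans_le (iInf_le _ i)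
    let K : Fin s → Submodule R (M ⧸ N) := fun i => (Ns i).map N.mkQ
    let W : Fin s → Submodule R (M ⧸ N) := fun i => (Finset.univ.erase i).inf K
    have hWK (i j : Fin s) (hji : j ≠ i) : W j ≤ K i := Finset.inf_le (by simpa using hji.symm)
    have hUW {U : Submodule R (M ⧸ N)} (hU : UniformSub R U) {i : Fin s}
        (hUi : leftPrime R U = X i) : U ⊓ W i ≠ ⊥ := by
      refine hU.finset_inf_ne_bot K _ fun j hj h => (Finset.mem_erase.1 hj).1 (hXinj ?_)
      have := hU.leftPrime_mem_of_inf_map_mkQ (hle j) h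
      rw [hass j, hUi] at this
      exact (Set.mem_singleton_iff.1 this).symm
    have hd (i : Fin s) : Disjoint (W i) (K i) := by
      rw [disjoint_iff, inf_comm, ← Finset.inf_insert, Finset.insert_erase (Finset.mem_univ i)]
      exact finset_inf_map_mkQ_eq_bot hshort.1.1
    have hsum (i : Fin s) : (⨆ (j) (_ : j ≠ i), W j) ≤ K i := iSup₂_le (hWK i)
    have hW0 (i : Fin s) : W i ≠ ⊥ := fun h => by
      obtain ⟨U, hU, hUi⟩ := hX i
      exact hUW hU hUi.symm (by rw [h, inf_bot_eq])
    have hC (i : Fin s) := exists_isComplementTo (hd i)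
    choose C hKC hC using hC
    refine ⟨W, hW0, fun i => (hd i).mono_right (hsum i), fun L hL h => ?_, fun i => ?_, C,
      fun i => ⟨fun j hj => (hWK i j hj).trans (hKC i), hC i, hsum i, hKC i⟩⟩
    · obtain ⟨U, hUL, hU⟩ := exists_uniformSub_le (huf N) hL
      obtain ⟨i, hi⟩ := hshort.1.exists_leftPrime_eq hass hU
      refine hUW hU hi.symm (le_bot_iff.1 (le_trans ?_ h.le))
      exact le_inf (inf_le_right.trans (le_iSup W i)) (inf_le_left.trans hUL)
    · have hsub {U : Submodule R (M ⧸ N)} (hU : UniformSub R U) (hUi : U ≤ W i) :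
          leftPrime R U = X i := by
        have := hU.leftPrime_mem_of_inf_map_mkQ (hle i) (disjoint_iff.1 ((hd i).mono_left hUi))
        rwa [hass i] at this
      ext y
      rw [mem_leftAss_submodule, Set.mem_singleton_iff]
      constructor
      · rintro ⟨U, hUi, hU, rfl⟩
        exact hsub hU hUi
      · rintro rfl
        obtain ⟨U, hUi, hU⟩ := exists_uniformSub_le (huf N) (hW0 i)
        exact ⟨U, hUi, hU, (hsub hU hUi).symm⟩
  · intro W hW0 hW hess hWX C hC N' hle hass' hN'
    refine ⟨⟨?_, fun i => ⟨X i, huf _, hass' i⟩⟩, hshort.2⟩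
    refine le_antisymm (le_iInf hle) (map_mkQ_eq_bot.1 ?_)
    by_contra hne
    obtain ⟨U, hU, hUu⟩ := exists_uniformSub_le (huf N) hne
    obtain ⟨i, hi⟩ := hshort.1.exists_leftPrime_eq hass hUu
    have hUC : U ≤ C i := (hU.trans (Submodule.map_mono (iInf_le _ i))).trans (hN' i).2
    have hUW : (⨆ j, W j) ⊓ U ≠ ⊥ := hess U hUu.ne_bot
    have hV := hUu.mono inf_le_right hUW
    have hVW : Disjoint ((⨆ j, W j) ⊓ U) (W i) :=
      (disjoint_iff.2 (hC i).2.1).symm.mono_left (inf_le_right.trans hUC)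
    have hd : Disjoint (W i) ((Finset.univ.erase i).sup W) := by
      rw [Finset.sup_eq_iSup]
      simpa using hW i
    have hVle : (⨆ j, W j) ⊓ U ≤ W i ⊔ (Finset.univ.erase i).sup W := by
      rw [← Finset.sup_insert, Finset.insert_erase (Finset.mem_univ i), Finset.sup_univ_eq_iSup]
      exact inf_le_left
    obtain ⟨V, hVle', hVu, hVeq⟩ :=
      mem_leftAss_submodule.1 (hV.leftPrime_mem_of_le_sup hVle hd hVW)
    obtain ⟨j, hj, hmem⟩ := exists_leftPrime_mem_of_le_finset_sup W hW _ hVu hVle'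
    rw [← hVeq, hUu.leftPrime_eq inf_le_right hUW, ← hi, hWX j] at hmem
    exact (Finset.mem_erase.1 hj).1 (hXinj hmem).symm
end

section
/- Let M be a nonzero uniformly finite R-module, N a submodule with N ≠ M, and N = N₁ ∩ ⋯ ∩ Nₙ a shortest uniform decomposition of N in M; set X_i := [M/N_i]. Let (after reordering) X₁, ..., X_s be the distinct left primes among X₁, ..., Xₙ, and for each i = 1, ..., s let n_i be the number of indices j ∈ {1, ..., n} with X_j = X_i. Then As_R(M/N) = {X₁, ..., X_s} and n_i = mult_{M/N}(X_i) for all i = 1, ..., s. -/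
/-!
Definitions following Bavula, "Primary decompositions for left Noetherian rings".
All modules are left modules over an associative ring `R` with 1.
-/

universe u v

section Lattice

variable {α ι κ : Type*} [Lattice α] [IsModularLattice α] [BoundedOrder α]

theorem InfIrred.sup_inf_ne_bot {a b k : α} (hk : InfIrred k) (hab : Disjoint a b)
    (ha : a ≠ ⊥) (hb : b ≠ ⊥) : (a ⊔ b) ⊓ k ≠ ⊥ := by
  intro h
  have hd : Disjoint a (b ⊔ k) :=
    hab.disjoint_sup_right_of_disjoint_sup_left (disjoint_iff.2 h)
  have hinf : (k ⊔ a) ⊓ (b ⊔ k) = k := by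
    rw [sup_inf_assoc_of_le a le_sup_right, hd.eq_bot, sup_bot_eq]
  have key : ∀ c, c ≤ a ⊔ b → c ≤ k → c = ⊥ := fun c h₁ h₂ =>
    le_bot_iff.1 (h ▸ le_inf h₁ h₂)
  rcases hk.2 hinf with h' | h'
  · exact ha (key a le_sup_left (sup_eq_left.1 h'))
  · exact hb (key b le_sup_right (sup_eq_right.1 h'))

/-- An independent family of nonzero elements of a modular lattice has at most as many members
as there are meet-irreducible elements whose meet is disjoint from its join. -/
theorem Finset.SupIndep.card_le_of_infIrred {k : κ → α} (s : Finset κ)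
    (hk : ∀ i ∈ s, InfIrred (k i)) {t : Finset ι} {f : ι → α} (hf : t.SupIndep f)
    (hne : ∀ j ∈ t, f j ≠ ⊥) (hd : Disjoint (t.sup f) (s.inf k)) : t.card ≤ s.card := by
  classical
  induction s using Finset.induction_on generalizing t f with
  | empty =>
    have hbot : t.sup f = ⊥ := by simpa using hd
    rw [Finset.card_empty, Nat.le_zero, Finset.card_eq_zero, Finset.eq_empty_iff_forall_notMem]
    exact fun j hj => hne j hj (le_bot_iff.1 (hbot ▸ Finset.le_sup (f := f) hj))
  | insert a s ha ih =>
    rw [Finset.card_insert_of_notMem ha]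
    rw [Finset.inf_insert] at hd
    have hks : ∀ i ∈ s, InfIrred (k i) := fun i hi => hk i (Finset.mem_insert_of_mem hi)
    by_cases h : ∃ i ∈ t, f i ⊓ k a = ⊥
    · obtain ⟨i, hi, hik⟩ := h
      have hcard := Finset.card_erase_add_one hi
      suffices (t.erase i).card ≤ s.card by omega
      refine ih hks (t := t.erase i) (f := fun j => (f i ⊔ f j) ⊓ k a) ?_ ?_ ?_
      · intro r hr j hj hjr
        have hdj : Disjoint (f j) (f i ⊔ r.sup f) := by
          rw [← Finset.sup_insert]
          refine hf (Finset.insert_subset hi (hr.trans (Finset.erase_subset _ _)))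
            (Finset.mem_of_mem_erase hj) ?_
          simp [hjr, Finset.ne_of_mem_erase hj]
        have hmod : (f i ⊔ f j) ⊓ (f i ⊔ r.sup f) = f i := by
          rw [sup_inf_assoc_of_le (f j) le_sup_left, hdj.eq_bot, sup_bot_eq]
        have hle : r.sup (fun j => (f i ⊔ f j) ⊓ k a) ≤ f i ⊔ r.sup f :=
          Finset.sup_le fun l hl => inf_le_left.trans
            (sup_le_sup_left (Finset.le_sup (f := f) hl) _)
        rw [disjoint_iff_inf_le, ← hik]
        exact le_inf ((inf_le_inf inf_le_left hle).trans hmod.le)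
          (inf_le_left.trans inf_le_right)
      · intro j hj
        have hij : Disjoint (f i) (f j) :=
          hf.pairwiseDisjoint hi (Finset.mem_of_mem_erase hj) (Finset.ne_of_mem_erase hj).symm
        exact (hk a (Finset.mem_insert_self a s)).sup_inf_ne_bot hij (hne i hi)
          (hne j (Finset.mem_of_mem_erase hj))
      · rw [disjoint_iff_inf_le] at hd ⊢
        refine le_trans (le_inf (inf_le_left.trans (Finset.sup_le fun j hj => ?_))
          (le_inf (inf_le_left.trans (Finset.sup_le fun j _ => inf_le_right)) inf_le_right)) hd
        exact inf_le_left.trans (sup_le (Finset.le_sup hi)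
          (Finset.le_sup (Finset.mem_of_mem_erase hj)))
    · push Not at h
      refine (ih hks (f := fun j => f j ⊓ k a) ?_ h ?_).trans (Nat.le_succ _)
      · intro r hr j hj hjr
        exact (hf hr hj hjr).mono inf_le_left (Finset.sup_mono_fun fun l _ => inf_le_left)
      · rw [disjoint_iff_inf_le] at hd ⊢
        exact le_trans (le_inf (inf_le_left.trans (Finset.sup_mono_fun fun l _ => inf_le_left))
          (le_inf (inf_le_left.trans (Finset.sup_le fun j _ => inf_le_right)) inf_le_right)) hd

end Lattice

section Uniform

variable {R : Type u} [Ring R] {A B : Type v} [AddCommGroup A] [Module R A]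
  [AddCommGroup B] [Module R B]

theorem UniformMod.infIrred_ker (hB : UniformMod R B) {φ : A →ₗ[R] B}
    (hφ : Function.Surjective φ) : InfIrred (LinearMap.ker φ) := by
  have := hB.1
  constructor
  · rw [isMax_iff_eq_top, LinearMap.ker_eq_top]
    rintro rfl
    obtain ⟨b, hb⟩ := exists_ne (0 : B)
    obtain ⟨a, rfl⟩ := hφ b
    exact hb rfl
  · intro P Q h
    by_contra! hne
    have hmap : ∀ S : Submodule R A, LinearMap.ker φ ≤ S → S ≠ LinearMap.ker φ → S.map φ ≠ ⊥ :=
      fun S hS hSne hbot => hSne (le_antisymm (LinearMap.le_ker_iff_map.2 hbot) hS)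
    have hQ : LinearMap.ker φ ≤ Q := h ▸ inf_le_right
    refine hB.2 _ (hmap P (h ▸ inf_le_left) hne.1) _ (hmap Q hQ hne.2) ?_
    rw [eq_bot_iff]
    rintro _ ⟨⟨p, hp, rfl⟩, q, hq, hqp⟩
    have hpq : p - q ∈ Q := hQ (by simp [hqp])
    have hpQ : p ∈ Q := by simpa using Q.add_mem hpq hq
    have : p ∈ P ⊓ Q := ⟨hp, hpQ⟩
    rw [h] at this
    exact this

theorem UniformMod.of_injective (hB : UniformMod R B) {φ : A →ₗ[R] B}
    (hφ : Function.Injective φ) (hA : Nontrivial A) : UniformMod R A := by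
  refine ⟨hA, fun V hV L hL h => ?_⟩
  have hmap : ∀ S : Submodule R A, S ≠ ⊥ → S.map φ ≠ ⊥ := fun S hS h' =>
    hS (le_bot_iff.1 (LinearMap.ker_eq_bot.2 hφ ▸ LinearMap.le_ker_iff_map.2 h'))
  refine hB.2 _ (hmap V hV) _ (hmap L hL) ?_
  rw [← Submodule.map_inf φ hφ, h, Submodule.map_bot]

theorem UniformMod.leftPrime_eq_of_injective (hB : UniformMod R B) {φ : A →ₗ[R] B}
    (hφ : Function.Injective φ) (hA : Nontrivial A) : leftPrime R A = leftPrime R B := by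
  refine Quot.sound ⟨⊤, LinearMap.range φ, fun L hL => by simpa using hL, hB.2 _ ?_,
    ⟨Submodule.topEquiv.trans (LinearEquiv.ofInjective φ hφ)⟩⟩
  obtain ⟨a, ha⟩ := exists_ne (0 : A)
  intro h
  rw [LinearMap.range_eq_bot] at h
  exact ha (hφ (by simp [h]))

theorem UniformMod.uniformSub_and_leftPrime_eq (hB : UniformMod R B) (φ : A →ₗ[R] B)
    {U : Submodule R A} (hU : U ≠ ⊥) (hd : Disjoint U (LinearMap.ker φ)) :
    UniformSub R U ∧ leftPrime R U = leftPrime R B := by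
  have hinj : Function.Injective (φ.domRestrict U) := by
    rw [← LinearMap.ker_eq_bot, LinearMap.ker_domRestrict, ← Submodule.disjoint_iff_comap_eq_bot]
    exact hd
  have hnt : Nontrivial U := Submodule.nontrivial_iff_ne_bot.2 hU
  exact ⟨hB.of_injective hinj hnt, hB.leftPrime_eq_of_injective hinj hnt⟩

theorem UniformSub.inf_ne_bot_s19 {U : Submodule R A} (hU : UniformSub R U) {P Q : Submodule R A}
    (hP : U ⊓ P ≠ ⊥) (hQ : U ⊓ Q ≠ ⊥) : U ⊓ (P ⊓ Q) ≠ ⊥ := by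
  have hcomap : ∀ S : Submodule R A, S.comap U.subtype = ⊥ ↔ U ⊓ S = ⊥ := fun S => by
    rw [← Submodule.disjoint_iff_comap_eq_bot, disjoint_iff]
  rw [Ne, ← hcomap, Submodule.comap_inf]
  exact hU.2 _ (mt (hcomap P).1 hP) _ (mt (hcomap Q).1 hQ)

theorem UniformSub.exists_disjoint {κ : Type*} {U : Submodule R A} (hU : UniformSub R U)
    {k : κ → Submodule R A} (s : Finset κ) (hd : Disjoint U (s.inf k)) :
    ∃ i ∈ s, Disjoint U (k i) := by
  classical
  have := hU.1
  by_contra! h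
  suffices U ⊓ s.inf k ≠ ⊥ from this hd.eq_bot
  clear hd
  induction s using Finset.induction_on with
  | empty => simpa using Submodule.nontrivial_iff_ne_bot.1 hU.1
  | insert a s _ ih =>
    rw [Finset.inf_insert]
    exact hU.inf_ne_bot_s19 (fun h' => h a (Finset.mem_insert_self a s) (disjoint_iff.2 h'))
      (ih fun i hi => h i (Finset.mem_insert_of_mem hi))

theorem essentialSub_iSup_of_infIrred {n : ℕ} {k W : Fin n → Submodule R A}
    (hk : ∀ i, InfIrred (k i)) (hbot : ⨅ i, k i = ⊥) (hW : iSupIndep W) (hne : ∀ i, W i ≠ ⊥) :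
    EssentialSub R (⨆ i, W i) := by
  intro L hL h
  have hind : (Finset.univ : Finset (Option (Fin n))).SupIndep (fun o => o.elim L W) := by
    have huniv : (Finset.univ : Finset (Option (Fin n))) =
        insert none (Finset.univ.map Function.Embedding.some) := by
      ext (_ | i) <;> simp
    rw [huniv]
    refine Finset.SupIndep.insert ?_ ?_
    · rw [Finset.supIndep_map]
      exact iSupIndep_iff_supIndep_univ.1 hW
    · rw [Finset.sup_map, disjoint_iff, inf_comm]
      simpa [Finset.sup_univ_eq_iSup, Function.comp_def] using h
  have hcard := hind.card_le_of_infIrred Finset.univ (fun i _ => hk i)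
    (by rintro (_ | i) _; exacts [hL, hne i]) (by simp [Finset.inf_univ_eq_iInf, hbot])
  simp at hcard

end Uniform

/-- Corollary `1clstun`: let `N = N₁ ∩ ⋯ ∩ Nₙ` be a shortest
uniform decomposition of a proper submodule `N` of a nonzero uniformly finite module
`M`, and set `Xᵢ := [M/Nᵢ]`. Then `As_R(M/N)` consists exactly of the left primes
`X₁, …, Xₙ`, and for each left prime `x` occurring among them, its multiplicity in
`M/N` equals the number of indices `j` with `Xⱼ = x`. -/
theorem leftAss_and_mult_of_shortest_uniformDecomposition
    {R : Type u} [Ring R] {M : Type v} [AddCommGroup M] [Module R M]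
    (hM : Nontrivial M) (huf : UniformlyFinite R M)
    (N : Submodule R M) (hN : N ≠ ⊤)
    (n : ℕ) (Ns : Fin n → Submodule R M)
    (hdec : N = ⨅ i, Ns i) (huni : ∀ i, UniformMod R (M ⧸ Ns i))
    (hshort : UdimEq R (M ⧸ N) n)
    (X : Fin n → LeftSpec.{u, v} R) (hX : ∀ i, X i = leftPrime R (M ⧸ Ns i)) :
    leftAss R (M ⧸ N) = Set.range X ∧
    ∀ x ∈ Set.range X, HasMult R (M ⧸ N) x (Nat.card {j : Fin n // X j = x}) := by
  let φ : ∀ i, (M ⧸ N) →ₗ[R] (M ⧸ Ns i) := fun i =>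
    Submodule.factor (hdec.trans_le (iInf_le Ns i))
  let k : Fin n → Submodule R (M ⧸ N) := fun i => LinearMap.ker (φ i)
  have hk : ∀ i, InfIrred (k i) := fun i => (huni i).infIrred_ker (Submodule.factor_surjective _)
  have hbot : ⨅ i, k i = ⊥ := by
    rw [eq_bot_iff]
    intro x hx
    obtain ⟨m, rfl⟩ := Submodule.Quotient.mk_surjective N x
    rw [Submodule.mem_bot, Submodule.Quotient.mk_eq_zero, hdec, Submodule.mem_iInf]
    intro i
    exact (Submodule.Quotient.mk_eq_zero (Ns i)).1 ((Submodule.mem_iInf _).1 hx i)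
  let W : Fin n → Submodule R (M ⧸ N) := fun i => (Finset.univ.erase i).inf k
  have hWk : ∀ i, Disjoint (W i) (k i) := fun i => by
    rw [disjoint_iff, inf_comm, ← Finset.inf_insert, Finset.insert_erase (Finset.mem_univ i),
      Finset.inf_univ_eq_iInf, hbot]
  have hWne : ∀ i, W i ≠ ⊥ := by
    intro i hi
    obtain ⟨U, hU, hind, -⟩ := hshort
    have hcard := (iSupIndep_iff_supIndep_univ.1 hind).card_le_of_infIrred (Finset.univ.erase i)
      (fun j _ => hk j) (fun j _ => Submodule.nontrivial_iff_ne_bot.1 (hU j).1)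
      (show Disjoint _ (W i) from hi ▸ disjoint_bot_right)
    exact absurd hcard (Finset.card_erase_lt_of_mem (Finset.mem_univ i)).not_ge
  have hWind : iSupIndep W := fun i => (hWk i).mono_right
    (iSup₂_le fun j hj => Finset.inf_le (Finset.mem_erase.2 ⟨hj.symm, Finset.mem_univ i⟩))
  have hWX : ∀ i, UniformSub R (W i) ∧ leftPrime R (W i) = X i := fun i => by
    rw [hX]
    exact (huni i).uniformSub_and_leftPrime_eq (φ i) (hWne i) (hWk i)
  refine ⟨Set.Subset.antisymm ?_ ?_, fun x _ => ⟨n, W, fun i => (hWX i).1, hWind,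
    essentialSub_iSup_of_infIrred hk hbot hWind hWne, by simp only [hWX]⟩⟩
  · rintro _ ⟨U, hU, rfl⟩
    obtain ⟨i, -, hi⟩ := hU.exists_disjoint (k := k) Finset.univ
      (by simp [Finset.inf_univ_eq_iInf, hbot])
    refine ⟨i, ?_⟩
    rw [hX]
    exact ((huni i).uniformSub_and_leftPrime_eq (φ i)
      (Submodule.nontrivial_iff_ne_bot.1 hU.1) hi).2.symm
  · rintro _ ⟨i, rfl⟩
    exact ⟨W i, (hWX i).1, (hWX i).2.symm⟩
end
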